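/- Let u, v ∈ A₁ be weights on ℝⁿ and let 1 < p < ∞. Then there is a dimensional constant c_n such that for every f ∈ L^p(uv): ‖M(fu)/u‖_{L^p(uv)} ≤ c_n p' [v]_{A₁}^{1/(p-1)} [u]_{A₁} ‖f‖_{L^p(uv)}, where p' = p/(p-1); equivalently, ( ∫ M(fu)^p v u^{1-p} dx )^{1/p} ≤ c_n p' [v]_{A₁}^{1/(p-1)} [u]_{A₁} ( ∫ |f|^p u v dx )^{1/p}. -/

import Mathlib

open MeasureTheory ENNReal NNReal

noncomputable section

/-- An axis-parallel cube in `ℝⁿ`. -/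
def IsCube {n : ℕ} (Q : Set (Fin n → ℝ)) : Prop :=
  ∃ (a : Fin n → ℝ) (h : ℝ), 0 < h ∧ Q = {x | ∀ i, a i ≤ x i ∧ x i ≤ a i + h}

/-- Average `(1/|Q|) ∫_Q f` of an `ℝ≥0∞`-valued function over a set. -/
def cubeAvg {n : ℕ} (f : (Fin n → ℝ) → ℝ≥0∞) (Q : Set (Fin n → ℝ)) : ℝ≥0∞ :=
  (∫⁻ x in Q, f x) / MeasureTheory.volume Q

/-- The uncentered Hardy–Littlewood maximal operator over axis-parallel cubes,
for `ℝ≥0∞`-valued functions. -/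
def hlM {n : ℕ} (f : (Fin n → ℝ) → ℝ≥0∞) (x : Fin n → ℝ) : ℝ≥0∞ :=
  ⨆ (Q : Set (Fin n → ℝ)) (_ : IsCube Q) (_ : x ∈ Q), cubeAvg f Q

/-- The Hardy–Littlewood maximal operator applied to a real-valued function:
`Mf(x) = sup_{Q ∋ x} (1/|Q|) ∫_Q |f|`. -/
def hlMR {n : ℕ} (f : (Fin n → ℝ) → ℝ) : (Fin n → ℝ) → ℝ≥0∞ :=
  hlM (fun y => ENNReal.ofReal |f y|)

/-- A weight: a locally integrable, a.e. positive function. -/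
def IsWeight {n : ℕ} (w : (Fin n → ℝ) → ℝ) : Prop :=
  MeasureTheory.LocallyIntegrable w MeasureTheory.volume ∧
    ∀ᵐ x ∂(MeasureTheory.volume : MeasureTheory.Measure (Fin n → ℝ)), 0 < w x

/-- `w(E) = ∫_E w dx`. -/
def wMeas {n : ℕ} (w : (Fin n → ℝ) → ℝ) (E : Set (Fin n → ℝ)) : ℝ≥0∞ :=
  ∫⁻ x in E, ENNReal.ofReal (w x)

/-- The `A₁` constant `[w]_{A₁} = ess sup_x M w(x) / w(x)`. -/
def a1Const {n : ℕ} (w : (Fin n → ℝ) → ℝ) : ℝ≥0∞ :=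
  essSup (fun x => hlM (fun y => ENNReal.ofReal (w y)) x / ENNReal.ofReal (w x))
    MeasureTheory.volume

/-- The Fujii–Wilson `A_∞` constant `[w]_{A_∞} = sup_Q (1/∫_Q w) ∫_Q M(w·1_Q)`. -/
def aInfConst {n : ℕ} (w : (Fin n → ℝ) → ℝ) : ℝ≥0∞ :=
  ⨆ (Q : Set (Fin n → ℝ)) (_ : IsCube Q),
    (∫⁻ x in Q, hlM (Q.indicator fun y => ENNReal.ofReal (w y)) x) / wMeas w Q

/-- The `A_p` constant, `1 < p < ∞`:
`[w]_{A_p} = sup_Q ⟨w⟩_Q (⟨w^{-1/(p-1)}⟩_Q)^{p-1}`. -/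
def apConst {n : ℕ} (p : ℝ) (w : (Fin n → ℝ) → ℝ) : ℝ≥0∞ :=
  ⨆ (Q : Set (Fin n → ℝ)) (_ : IsCube Q),
    cubeAvg (fun y => ENNReal.ofReal (w y)) Q *
      (cubeAvg (fun y => ENNReal.ofReal (w y) ^ (-(1 / (p - 1)))) Q) ^ (p - 1)

/-- The weak norm `‖g‖_{L^{1,∞}(σ)} = sup_{t>0} t · σ({x : g(x) > t})`
for an `ℝ≥0∞`-valued function `g` and a weight `σ`. -/
def wkNorm {n : ℕ} (g : (Fin n → ℝ) → ℝ≥0∞) (σ : (Fin n → ℝ) → ℝ) : ℝ≥0∞ :=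
  ⨆ (t : ℝ≥0) (_ : 0 < t), (t : ℝ≥0∞) * wMeas σ {x | (t : ℝ≥0∞) < g x}

/-- `‖f‖_{L¹(σ)} = ∫ |f| σ dx`. -/
def l1Norm {n : ℕ} (f : (Fin n → ℝ) → ℝ) (σ : (Fin n → ℝ) → ℝ) : ℝ≥0∞ :=
  ∫⁻ x, ENNReal.ofReal |f x| * ENNReal.ofReal (σ x)

/-- `‖g‖_{L^p(σ)} = (∫ g^p σ dx)^{1/p}` for an `ℝ≥0∞`-valued `g`. -/
def lpNormE {n : ℕ} (p : ℝ) (g : (Fin n → ℝ) → ℝ≥0∞) (σ : (Fin n → ℝ) → ℝ) : ℝ≥0∞ :=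
  (∫⁻ x, g x ^ p * ENNReal.ofReal (σ x)) ^ (1 / p)

/-- A bounded, compactly supported measurable function. -/
def BddCompSupp {n : ℕ} (f : (Fin n → ℝ) → ℝ) : Prop :=
  Measurable f ∧ (∃ C : ℝ, ∀ x, |f x| ≤ C) ∧ HasCompactSupport f

end


section NestedFamilies

variable {X ι : Type*} [MeasurableSpace X]

/-- Any two members of the family are comparable or disjoint. -/
def IsNestedFamily (D : ι → Set X) : Prop :=
  ∀ i j, D i ⊆ D j ∨ D j ⊆ D i ∨ Disjoint (D i) (D j)

/-- The maximal operator with respect to `μ` over finitely many members of a family of sets. -/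
noncomputable def familyMax (μ : Measure X) (S : Finset ι) (D : ι → Set X) (g : X → ℝ≥0∞) (x : X) : ℝ≥0∞ :=
  ⨆ i ∈ S, (D i).indicator (fun _ => (∫⁻ y in D i, g y ∂μ) / μ (D i)) x

theorem le_familyMax {μ : Measure X} {S : Finset ι} {D : ι → Set X} {g : X → ℝ≥0∞} {x : X} {i : ι}
    (hi : i ∈ S) (hx : x ∈ D i) : (∫⁻ y in D i, g y ∂μ) / μ (D i) ≤ familyMax μ S D g x := by
  refine le_trans ?_ (le_iSup₂ (f := fun i (_ : i ∈ S) =>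
    (D i).indicator (fun _ => (∫⁻ y in D i, g y ∂μ) / μ (D i)) x) i hi)
  rw [Set.indicator_of_mem hx]

theorem measurable_familyMax (μ : Measure X) (S : Finset ι) {D : ι → Set X}
    (hD : ∀ i, MeasurableSet (D i)) (g : X → ℝ≥0∞) : Measurable (familyMax μ S D g) := by
  unfold familyMax
  exact Measurable.biSup _ S.countable_toSet fun i _ => measurable_const.indicator (hD i)

theorem IsNestedFamily.mul_measure_biUnion_le {D : ι → Set X} (hN : IsNestedFamily D)
    (hD : ∀ i, MeasurableSet (D i)) (μ ρ : Measure X) (t : ℝ≥0∞) (S : Finset ι)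
    (h : ∀ i ∈ S, t * μ (D i) ≤ ρ (D i)) : t * μ (⋃ i ∈ S, D i) ≤ ρ (⋃ i ∈ S, D i) := by
  classical
  induction S using Finset.strongInduction with
  | H S ih =>
    rcases S.eq_empty_or_nonempty with rfl | hS
    · simp
    by_cases hne : ∀ i ∈ S, D i = ∅
    · have : (⋃ i ∈ S, D i) = ∅ := by simpa using hne
      simp [this]
    push Not at hne
    obtain ⟨a₀, ha₀, hne₀⟩ := hne
    obtain ⟨a, ha⟩ := Finset.exists_maximalFor D (S.filter fun i => (D i).Nonempty)
      ⟨a₀, by simp [ha₀, hne₀]⟩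
    obtain ⟨haS, hane⟩ := Finset.mem_filter.1 ha.prop
    set T := S.filter fun i => Disjoint (D i) (D a) with hT
    have hTS : T ⊂ S := by
      refine Finset.filter_ssubset.2 ⟨a, haS, ?_⟩
      rw [disjoint_self]
      exact hane.ne_empty
    have hU : (⋃ i ∈ S, D i) = D a ∪ ⋃ i ∈ T, D i := by
      apply subset_antisymm
      · refine Set.iUnion₂_subset fun i hi => ?_
        rcases (D i).eq_empty_or_nonempty with he | hine
        · simp [he]
        rcases hN i a with h1 | h1 | h1
        · exact h1.trans Set.subset_union_left
        · exact (ha.le_of_le (by simp [hi, hine]) h1).trans Set.subset_union_left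
        · exact (Set.subset_biUnion_of_mem (u := D) (by simp [hT, hi, h1] : i ∈ (T : Set ι))).trans
            Set.subset_union_right
      · refine Set.union_subset (Set.subset_biUnion_of_mem (u := D) (by simpa using haS)) ?_
        exact Set.biUnion_subset_biUnion_left fun i hi => hTS.1 hi
    have hdis : Disjoint (D a) (⋃ i ∈ T, D i) := by
      simp only [Set.disjoint_iUnion_right]
      intro i hi
      exact (Finset.mem_filter.1 hi).2.symm
    have hm : MeasurableSet (⋃ i ∈ T, D i) := T.measurableSet_biUnion fun i _ => hD i
    rw [hU, measure_union hdis hm, measure_union hdis hm, mul_add]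
    exact add_le_add (h a haS) (ih T hTS fun i hi => h i (hTS.1 hi))

theorem IsNestedFamily.mul_measure_familyMax_le {D : ι → Set X} (hN : IsNestedFamily D)
    (hD : ∀ i, MeasurableSet (D i)) (μ : Measure X) (S : Finset ι)
    (g : X → ℝ≥0∞) (t : ℝ≥0∞) :
    t * μ {x | t < familyMax μ S D g x} ≤ (μ.withDensity g) {x | t < familyMax μ S D g x} := by
  classical
  have hset : {x | t < familyMax μ S D g x} =
      ⋃ i ∈ S.filter (fun i => t < (∫⁻ y in D i, g y ∂μ) / μ (D i)), D i := by
    ext x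
    simp only [familyMax, Set.mem_ofPred_eq, lt_iSup_iff, Set.mem_iUnion, Finset.mem_filter,
      exists_prop]
    refine exists_congr fun i => ?_
    by_cases hx : x ∈ D i <;> simp [hx]
  rw [hset]
  refine hN.mul_measure_biUnion_le hD _ _ _ _ fun i hi => ?_
  obtain ⟨hi, hlt⟩ := Finset.mem_filter.1 hi
  rw [withDensity_apply _ (hD i)]
  exact ENNReal.mul_le_of_le_div hlt.le

theorem IsNestedFamily.lintegral_familyMax_rpow_le {D : ι → Set X} (hN : IsNestedFamily D)
    (hD : ∀ i, MeasurableSet (D i)) (μ : Measure X) (S : Finset ι)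
    (hfin : ∀ i ∈ S, μ (D i) ≠ ∞) {g : X → ℝ≥0∞} (hg : Measurable g) {p : ℝ} (hp : 1 < p) :
    ∫⁻ x, familyMax μ S D g x ^ p ∂μ ≤
      ENNReal.ofReal (p / (p - 1)) ^ p * ∫⁻ x, g x ^ p ∂μ := by
  have hp0 : 0 < p := by linarith
  have hp1 : 0 < p - 1 := by linarith
  by_cases hG : ∫⁻ x, g x ^ p ∂μ = ∞
  · rw [hG, ENNReal.mul_top]
    · exact le_top
    · simp [ENNReal.rpow_eq_zero_iff, div_pos hp0 hp1]
  set M := familyMax μ S D g with hM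
  have hMm : Measurable M := measurable_familyMax μ S hD g
  have hgD : ∀ i ∈ S, ∫⁻ y in D i, g y ∂μ ≠ ∞ := by
    intro i hi
    have h1 : ∫⁻ y in D i, g y ∂μ ≤ ∫⁻ y in D i, (1 + g y ^ p) ∂μ := by
      refine lintegral_mono fun y => ?_
      rcases le_total (g y) 1 with h | h
      · exact h.trans le_self_add
      · calc g y = g y ^ (1 : ℝ) := (ENNReal.rpow_one _).symm
          _ ≤ g y ^ p := ENNReal.rpow_le_rpow_of_exponent_le h hp.le
          _ ≤ _ := le_add_self
    refine ne_top_of_le_ne_top ?_ h1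
    rw [lintegral_add_left measurable_const, setLIntegral_const, one_mul]
    exact ENNReal.add_ne_top.2 ⟨hfin i hi, ne_top_of_le_ne_top hG (setLIntegral_le_lintegral _ _)⟩
  have havg : ∀ i ∈ S, (∫⁻ y in D i, g y ∂μ) / μ (D i) ≠ ∞ := by
    intro i hi h
    rcases ENNReal.div_eq_top.1 h with ⟨h1, h2⟩ | ⟨h1, -⟩
    · exact h1 (setLIntegral_measure_zero _ _ h2)
    · exact hgD i hi h1
  set C := ∑ i ∈ S, (∫⁻ y in D i, g y ∂μ) / μ (D i)
  have hCtop : C ≠ ∞ := ENNReal.sum_ne_top.2 havg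
  have hMle : ∀ x, M x ≤ (⋃ i ∈ S, D i).indicator (fun _ => C) x := by
    intro x
    refine iSup₂_le fun i hi => ?_
    by_cases hx : x ∈ D i
    · rw [Set.indicator_of_mem hx, Set.indicator_of_mem (Set.mem_iUnion₂.2 ⟨i, hi, hx⟩)]
      exact Finset.single_le_sum
        (f := fun i => (∫⁻ y in D i, g y ∂μ) / μ (D i)) (fun _ _ => zero_le) hi
    · simp [hx]
  have hMtop : ∀ x, M x ≠ ∞ := fun x => ne_top_of_le_ne_top hCtop
    ((hMle x).trans (Set.indicator_le_self _ _ x))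
  set I := ∫⁻ x, M x ^ p ∂μ with hI
  have hItop : I ≠ ∞ := by
    have h1 : I ≤ ∫⁻ x, (⋃ i ∈ S, D i).indicator (fun _ => C ^ p) x ∂μ := by
      refine lintegral_mono fun x => ?_
      refine (ENNReal.rpow_le_rpow (hMle x) hp0.le).trans ?_
      by_cases hx : x ∈ ⋃ i ∈ S, D i
      · rw [Set.indicator_of_mem hx, Set.indicator_of_mem hx]
      · rw [Set.indicator_of_notMem hx, Set.indicator_of_notMem hx, ENNReal.zero_rpow_of_pos hp0]
    refine ne_top_of_le_ne_top ?_ h1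
    rw [lintegral_indicator_const (S.measurableSet_biUnion fun i _ => hD i)]
    refine ENNReal.mul_ne_top (ENNReal.rpow_ne_top_of_nonneg hp0.le hCtop) ?_
    exact ne_top_of_le_ne_top (ENNReal.sum_ne_top.2 hfin) (measure_biUnion_finset_le _ _)
  have hcake : ∀ (ν : Measure X) (q : ℝ), 0 < q → ∫⁻ x, M x ^ q ∂ν =
      ENNReal.ofReal q * ∫⁻ t in Set.Ioi (0 : ℝ),
        ν {x | ENNReal.ofReal t < M x} * ENNReal.ofReal (t ^ (q - 1)) := by
    intro ν q hq
    have h1 := lintegral_rpow_eq_lintegral_meas_lt_mul ν (f := fun x => (M x).toReal)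
      (Filter.Eventually.of_forall fun x => ENNReal.toReal_nonneg) hMm.ennreal_toReal.aemeasurable hq
    rw [show (∫⁻ x, M x ^ q ∂ν) = ∫⁻ x, ENNReal.ofReal ((M x).toReal ^ q) ∂ν from
      lintegral_congr fun x => by
        rw [← ENNReal.ofReal_rpow_of_nonneg ENNReal.toReal_nonneg hq.le,
          ENNReal.ofReal_toReal (hMtop x)], h1]
    congr 1
    refine setLIntegral_congr_fun measurableSet_Ioi fun t ht => ?_
    simp only [ENNReal.ofReal_lt_iff_lt_toReal (le_of_lt ht) (hMtop _)]
  set ρ := μ.withDensity g with hρ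
  have hIJ : I ≤ ENNReal.ofReal (p / (p - 1)) * ∫⁻ x, M x ^ (p - 1) ∂ρ := by
    rw [hI, hcake μ p hp0, hcake ρ (p - 1) hp1, ← mul_assoc,
      ← ENNReal.ofReal_mul (div_pos hp0 hp1).le, div_mul_cancel₀ _ hp1.ne']
    refine mul_le_mul_right (setLIntegral_mono' measurableSet_Ioi fun t ht => ?_) _
    have ht' : 0 < t := ht
    have h1 := hN.mul_measure_familyMax_le hD μ S g (ENNReal.ofReal t)
    rw [show t ^ (p - 1) = t * t ^ (p - 1 - 1) by
      rw [Real.rpow_sub_one ht'.ne' (p - 1)]; field_simp, ENNReal.ofReal_mul ht'.le,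
      ← mul_assoc, mul_comm (μ _)]
    exact mul_le_mul_left h1 _
  have hJ : ∫⁻ x, M x ^ (p - 1) ∂ρ ≤ (∫⁻ x, g x ^ p ∂μ) ^ (1 / p) * I ^ (1 - 1 / p) := by
    rw [hρ, lintegral_withDensity_eq_lintegral_mul _ hg (hMm.pow_const _)]
    have hpq := Real.HolderConjugate.conjExponent hp
    refine (ENNReal.lintegral_mul_le_Lp_mul_Lq μ hpq hg.aemeasurable
      (hMm.pow_const _).aemeasurable).trans (le_of_eq ?_)
    have e1 : 1 / p.conjExponent = 1 - 1 / p := by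
      rw [Real.conjExponent]; field_simp
    have e2 : (p - 1) * p.conjExponent = p := by
      rw [Real.conjExponent]; field_simp
    rw [e1]
    simp only [← ENNReal.rpow_mul, e2, hI]
  by_cases hI0 : I = 0
  · rw [hI0]; exact zero_le
  have h2 : I ^ (1 / p) * I ^ (1 - 1 / p) ≤
      (ENNReal.ofReal (p / (p - 1)) * (∫⁻ x, g x ^ p ∂μ) ^ (1 / p)) * I ^ (1 - 1 / p) := by
    rw [← ENNReal.rpow_add _ _ hI0 hItop, add_sub_cancel, ENNReal.rpow_one, mul_assoc]
    exact hIJ.trans (mul_le_mul_right hJ _)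
  have hr0 : I ^ (1 - 1 / p) ≠ 0 := by simp [ENNReal.rpow_eq_zero_iff, hI0, hItop]
  have hrt : I ^ (1 - 1 / p) ≠ ∞ := by simp [ENNReal.rpow_eq_top_iff, hI0, hItop]
  have h3 := (ENNReal.mul_le_mul_iff_left hr0 hrt).1 h2
  have h4 := ENNReal.rpow_le_rpow h3 hp0.le
  rwa [ENNReal.mul_rpow_of_nonneg _ _ hp0.le, ← ENNReal.rpow_mul, ← ENNReal.rpow_mul,
    one_div_mul_cancel hp0.ne', ENNReal.rpow_one, ENNReal.rpow_one] at h4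

theorem IsNestedFamily.lintegral_familyMax_rpow_mul_le {D : ι → Set X} (hN : IsNestedFamily D)
    (hD : ∀ i, MeasurableSet (D i)) (m : Measure X) (S : Finset ι)
    (hm0 : ∀ i ∈ S, m (D i) ≠ 0) (hmt : ∀ i ∈ S, m (D i) ≠ ∞)
    {w : X → ℝ≥0∞} (hw : Measurable w) (hw0 : ∀ x, w x ≠ 0) (hwt : ∀ x, w x ≠ ∞)
    {p : ℝ} (hp : 1 < p) {A : ℝ≥0∞} (hAt : A ≠ ∞)
    (hA : ∀ i ∈ S, (∫⁻ x in D i, w x ^ (-(1 / (p - 1))) ∂m) ^ (p - 1) * ∫⁻ x in D i, w x ∂m ≤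
      A * m (D i) ^ p)
    {g : X → ℝ≥0∞} (hg : Measurable g) :
    ∫⁻ x, familyMax m S D g x ^ p * w x ∂m ≤
      (A ^ (1 / (p - 1)) * ENNReal.ofReal p ^ (1 / (p - 1)) * ENNReal.ofReal (p / (p - 1))) ^ p *
        ∫⁻ x, g x ^ p * w x ∂m := by
  have hp0 : 0 < p := by linarith
  have hp1 : 0 < p - 1 := by linarith
  set σ : X → ℝ≥0∞ := fun x => w x ^ (-(1 / (p - 1))) with hσ
  have hσm : Measurable σ := hw.pow_const _
  have hσ0 : ∀ x, σ x ≠ 0 := fun x => by simp [hσ, ENNReal.rpow_eq_zero_iff, hw0, hwt]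
  have hσt : ∀ x, σ x ≠ ∞ := fun x => by simp [hσ, ENNReal.rpow_eq_top_iff, hw0, hwt]
  set μ := m.withDensity w with hμ
  set ν := m.withDensity σ with hν
  have hpos : ∀ (f : X → ℝ≥0∞), Measurable f → (∀ x, f x ≠ 0) → ∀ i ∈ S,
      ∫⁻ x in D i, f x ∂m ≠ 0 := by
    intro f hf hf0 i hi
    rw [← pos_iff_ne_zero, setLIntegral_pos_iff hf]
    have : Function.support f = Set.univ := by ext x; simp [hf0 x]
    rw [this, Set.univ_inter]
    exact pos_iff_ne_zero.2 (hm0 i hi)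
  have hμD : ∀ i, μ (D i) = ∫⁻ x in D i, w x ∂m := fun i => withDensity_apply _ (hD i)
  have hνD : ∀ i, ν (D i) = ∫⁻ x in D i, σ x ∂m := fun i => withDensity_apply _ (hD i)
  have hμ0 : ∀ i ∈ S, μ (D i) ≠ 0 := fun i hi => by rw [hμD]; exact hpos w hw hw0 i hi
  have hν0 : ∀ i ∈ S, ν (D i) ≠ 0 := fun i hi => by rw [hνD]; exact hpos σ hσm hσ0 i hi
  have hA' : ∀ i ∈ S, ν (D i) ^ (p - 1) * μ (D i) ≤ A * m (D i) ^ p := fun i hi => by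
    rw [hμD, hνD]; exact hA i hi
  have hprod : ∀ i ∈ S, ν (D i) ^ (p - 1) * μ (D i) ≠ ∞ := fun i hi =>
    ne_top_of_le_ne_top (ENNReal.mul_ne_top hAt
      (ENNReal.rpow_ne_top_of_nonneg hp0.le (hmt i hi))) (hA' i hi)
  have hνp0 : ∀ i ∈ S, ν (D i) ^ (p - 1) ≠ 0 := fun i hi => by
    simp [ENNReal.rpow_eq_zero_iff, hν0 i hi, hp.le]
  have hμt : ∀ i ∈ S, μ (D i) ≠ ∞ := fun i hi h => hprod i hi (by
    rw [h, ENNReal.mul_top (hνp0 i hi)])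
  have hνt : ∀ i ∈ S, ν (D i) ≠ ∞ := fun i hi h => hprod i hi (by
    rw [h, ENNReal.top_rpow_of_pos hp1, ENNReal.top_mul (hμ0 i hi)])
  set G : X → ℝ≥0∞ := fun x => g x * (σ x)⁻¹ with hG
  have hGm : Measurable G := hg.mul hσm.inv
  set N := familyMax ν S D G with hNdef
  have hNm : Measurable N := measurable_familyMax ν S hD G
  set h : X → ℝ≥0∞ := fun x => N x ^ (p - 1) * (w x)⁻¹ with hh
  have hhm : Measurable h := (hNm.pow_const _).mul hw.inv
  set H := familyMax μ S D h with hHdef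
  have hHm : Measurable H := measurable_familyMax μ S hD h
  have hpt : ∀ x, familyMax m S D g x ≤ (A * H x) ^ (p - 1)⁻¹ := by
    intro x
    refine iSup₂_le fun i hi => ?_
    by_cases hx : x ∈ D i
    swap
    · simp [hx]
    rw [Set.indicator_of_mem hx, ENNReal.le_rpow_inv_iff hp1]
    set k := ∫⁻ y in D i, g y ∂m with hk
    have hkν : ∫⁻ y in D i, G y ∂ν = k := by
      rw [hν, setLIntegral_withDensity_eq_setLIntegral_mul _ hσm hGm (hD i)]
      refine lintegral_congr fun y => ?_
      simp only [Pi.mul_apply, hG]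
      rw [mul_left_comm, ENNReal.mul_inv_cancel (hσ0 y) (hσt y), mul_one]
    have hH : (k / ν (D i)) ^ (p - 1) * m (D i) / μ (D i) ≤ H x := by
      refine le_trans ?_ (le_familyMax hi hx)
      refine ENNReal.div_le_div_right ?_ _
      rw [hμ, setLIntegral_withDensity_eq_setLIntegral_mul _ hw hhm (hD i), ← setLIntegral_const]
      refine setLIntegral_mono' (hD i) fun y hy => ?_
      simp only [Pi.mul_apply, hh]
      rw [mul_left_comm, ENNReal.mul_inv_cancel (hw0 y) (hwt y), mul_one, ← hkν]
      exact ENNReal.rpow_le_rpow (le_familyMax hi hy) hp1.le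
    have hmp : m (D i) ^ p = m (D i) ^ (p - 1) * m (D i) := by
      conv_rhs => rw [← ENNReal.rpow_one (m (D i)), ← ENNReal.rpow_mul, one_mul,
        ← ENNReal.rpow_add _ _ (hm0 i hi) (hmt i hi), sub_add_cancel]
    have hZ0 : m (D i) ^ (p - 1) ≠ 0 := by simp [ENNReal.rpow_eq_zero_iff, hm0 i hi, hp.le]
    have hZt : m (D i) ^ (p - 1) ≠ ∞ := ENNReal.rpow_ne_top_of_nonneg hp1.le (hmt i hi)
    have hAge : ν (D i) ^ (p - 1) * μ (D i) / (m (D i) ^ (p - 1) * m (D i)) ≤ A := by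
      rw [← hmp]
      exact ENNReal.div_le_of_le_mul (hA' i hi)
    refine le_trans (le_of_eq ?_) (mul_le_mul' hAge hH)
    have e1 : k = k / ν (D i) * ν (D i) := (ENNReal.div_mul_cancel (hν0 i hi) (hνt i hi)).symm
    rw [ENNReal.div_rpow_of_nonneg _ _ hp1.le]
    conv_lhs => rw [e1]
    rw [ENNReal.mul_rpow_of_nonneg _ _ hp1.le]
    simp only [div_eq_mul_inv]
    rw [ENNReal.mul_inv (Or.inl hZ0) (Or.inl hZt)]
    calc _ = (k * (ν (D i))⁻¹) ^ (p - 1) * ν (D i) ^ (p - 1) * (m (D i) ^ (p - 1))⁻¹ *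
          (μ (D i) * (μ (D i))⁻¹) * (m (D i) * (m (D i))⁻¹) := by
          rw [ENNReal.mul_inv_cancel (hμ0 i hi) (hμt i hi),
            ENNReal.mul_inv_cancel (hm0 i hi) (hmt i hi), mul_one, mul_one]
      _ = _ := by ring
  set q := p / (p - 1) with hq
  have hq1 : 1 < q := by rw [hq, lt_div_iff₀ hp1]; linarith
  have hq0 : 0 < q := by linarith
  have hqq : q / (q - 1) = p := by rw [hq]; field_simp; ring
  calc ∫⁻ x, familyMax m S D g x ^ p * w x ∂m
      ≤ ∫⁻ x, A ^ q * (H x ^ q * w x) ∂m := by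
        refine lintegral_mono fun x => ?_
        rw [← mul_assoc]
        refine mul_le_mul_left ?_ _
        refine (ENNReal.rpow_le_rpow (hpt x) hp0.le).trans (le_of_eq ?_)
        rw [← ENNReal.rpow_mul, ← ENNReal.mul_rpow_of_nonneg _ _ hq0.le, hq]
        congr 1
        field_simp
    _ = A ^ q * ∫⁻ x, H x ^ q ∂μ := by
        rw [lintegral_const_mul (f := fun x => H x ^ q * w x) _ ((hHm.pow_const _).mul hw), hμ,
          lintegral_withDensity_eq_lintegral_mul _ hw (hHm.pow_const _)]
        simp only [Pi.mul_apply, mul_comm]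
    _ ≤ A ^ q * (ENNReal.ofReal p ^ q * ∫⁻ x, h x ^ q ∂μ) := by
        refine mul_le_mul_right ?_ _
        have := hN.lintegral_familyMax_rpow_le hD μ S hμt hhm hq1
        rwa [hqq] at this
    _ = A ^ q * (ENNReal.ofReal p ^ q * ∫⁻ x, N x ^ p ∂ν) := by
        rw [hμ, hν, lintegral_withDensity_eq_lintegral_mul _ hw (hhm.pow_const _),
          lintegral_withDensity_eq_lintegral_mul _ hσm (hNm.pow_const _)]
        congr 2
        refine lintegral_congr fun x => ?_
        simp only [Pi.mul_apply, hh, hσ]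
        rw [ENNReal.mul_rpow_of_nonneg _ _ hq0.le, ← ENNReal.rpow_mul,
          show (p - 1) * q = p by rw [hq]; field_simp, mul_left_comm, mul_comm,
          ENNReal.inv_rpow, ← ENNReal.rpow_neg]
        congr 1
        conv_lhs => rw [← ENNReal.rpow_one (w x), ← ENNReal.rpow_mul, one_mul,
          ← ENNReal.rpow_add _ _ (hw0 x) (hwt x)]
        congr 1
        rw [hq]; field_simp; ring
    _ ≤ A ^ q * (ENNReal.ofReal p ^ q * (ENNReal.ofReal (p / (p - 1)) ^ p *
          ∫⁻ x, G x ^ p ∂ν)) := by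
        gcongr
        exact hN.lintegral_familyMax_rpow_le hD ν S hνt hGm hp
    _ = A ^ q * (ENNReal.ofReal p ^ q * (ENNReal.ofReal (p / (p - 1)) ^ p *
          ∫⁻ x, g x ^ p * w x ∂m)) := by
        rw [hν, lintegral_withDensity_eq_lintegral_mul _ hσm (hGm.pow_const _)]
        congr 3
        refine lintegral_congr fun x => ?_
        simp only [Pi.mul_apply, hG]
        rw [ENNReal.mul_rpow_of_nonneg _ _ hp0.le, mul_left_comm, ENNReal.inv_rpow,
          ← ENNReal.rpow_neg]
        congr 1
        have hadd := ENNReal.rpow_add 1 (-p) (hσ0 x) (hσt x)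
        rw [ENNReal.rpow_one] at hadd
        rw [← hadd]
        simp only [hσ]
        rw [← ENNReal.rpow_mul, show -(1 / (p - 1)) * (1 + -p) = 1 by field_simp; ring,
          ENNReal.rpow_one]
    _ = _ := by
        rw [ENNReal.mul_rpow_of_nonneg _ _ hp0.le, ENNReal.mul_rpow_of_nonneg _ _ hp0.le,
          ← ENNReal.rpow_mul, ← ENNReal.rpow_mul, show 1 / (p - 1) * p = q by rw [hq]; field_simp]
        ring

end NestedFamilies

section MuckenhouptConditions

variable {X : Type*} [MeasurableSpace X]

/-- If `U` and `V` satisfy the `A₁` condition on `Q`, then `V U^{1-p}` satisfies the `A_p`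
condition on `Q`. -/
theorem lintegral_dual_rpow_mul_lintegral_le {m : Measure X} {Q : Set X}
    (hm0 : m Q ≠ 0) (hmt : m Q ≠ ∞) {U V : X → ℝ≥0∞} (hU : Measurable U) (hV : Measurable V)
    (hU0 : ∀ x, U x ≠ 0) (hUt : ∀ x, U x ≠ ∞) (hV0 : ∀ x, V x ≠ 0) (hVt : ∀ x, V x ≠ ∞)
    {a b : ℝ≥0∞} (hat : a ≠ ∞) (hbt : b ≠ ∞)
    (ha : ∀ᵐ x ∂m, x ∈ Q → (∫⁻ y in Q, U y ∂m) / m Q ≤ a * U x)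
    (hb : ∀ᵐ x ∂m, x ∈ Q → (∫⁻ y in Q, V y ∂m) / m Q ≤ b * V x) {p : ℝ} (hp : 1 < p) :
    (∫⁻ x in Q, (V x * U x ^ (1 - p)) ^ (-(1 / (p - 1))) ∂m) ^ (p - 1) *
      ∫⁻ x in Q, V x * U x ^ (1 - p) ∂m ≤ (b * a ^ (p - 1)) * m Q ^ p := by
  have hp1 : 0 < p - 1 := by linarith
  have key : ∀ (W : X → ℝ≥0∞), Measurable W → (∀ x, W x ≠ 0) → (∀ x, W x ≠ ∞) → ∀ c : ℝ≥0∞,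
      c ≠ ∞ → (∀ᵐ x ∂m, x ∈ Q → (∫⁻ y in Q, W y ∂m) / m Q ≤ c * W x) →
      c ≠ 0 ∧ (∫⁻ y in Q, W y ∂m) / m Q ≠ 0 ∧ (∫⁻ y in Q, W y ∂m) / m Q ≠ ∞ := by
    intro W hW hW0 hWt c hct hc
    have h0 : (∫⁻ y in Q, W y ∂m) / m Q ≠ 0 := by
      refine (ENNReal.div_pos ?_ hmt).ne'
      rw [← pos_iff_ne_zero, setLIntegral_pos_iff hW]
      have : Function.support W = Set.univ := by ext x; simp [hW0 x]
      rw [this, Set.univ_inter]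
      exact pos_iff_ne_zero.2 hm0
    have hex : ∃ x, (∫⁻ y in Q, W y ∂m) / m Q ≤ c * W x := by
      by_contra! hcon
      refine hm0 (measure_mono_null (fun x hx => ?_) (ae_iff.1 hc))
      simpa [hx] using hcon x
    obtain ⟨x, hx⟩ := hex
    refine ⟨fun h => h0 ?_, h0, ne_top_of_le_ne_top (ENNReal.mul_ne_top hct (hWt x)) hx⟩
    simpa [h] using hx
  obtain ⟨ha0, hA0, hAt⟩ := key U hU hU0 hUt a hat ha
  obtain ⟨hb0, hB0, hBt⟩ := key V hV hV0 hVt b hbt hb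
  set A := (∫⁻ y in Q, U y ∂m) / m Q with hA
  set B := (∫⁻ y in Q, V y ∂m) / m Q with hB
  have hUA : ∫⁻ y in Q, U y ∂m = A * m Q := (ENNReal.div_mul_cancel hm0 hmt).symm
  have hVB : ∫⁻ y in Q, V y ∂m = B * m Q := (ENNReal.div_mul_cancel hm0 hmt).symm
  have h1 : ∫⁻ x in Q, V x * U x ^ (1 - p) ∂m ≤ B * m Q * ((A / a) ^ (p - 1))⁻¹ := by
    rw [← hVB, ← lintegral_mul_const _ hV]
    refine setLIntegral_mono_ae (hV.mul_const _).aemeasurable ?_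
    filter_upwards [ha] with x hx hxQ
    rw [show (1 - p) = -(p - 1) by ring, ENNReal.rpow_neg]
    gcongr
    exact ENNReal.div_le_of_le_mul' (hx hxQ)
  have h2 : ∫⁻ x in Q, (V x * U x ^ (1 - p)) ^ (-(1 / (p - 1))) ∂m ≤
      A * m Q * ((B / b) ^ (1 / (p - 1)))⁻¹ := by
    rw [← hUA, ← lintegral_mul_const _ hU]
    refine setLIntegral_mono_ae (hU.mul_const _).aemeasurable ?_
    filter_upwards [hb] with x hx hxQ
    rw [ENNReal.mul_rpow_of_ne_top (hVt x) (by simp [ENNReal.rpow_eq_top_iff, hU0, hUt]),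
      ← ENNReal.rpow_mul, show (1 - p) * -(1 / (p - 1)) = 1 by field_simp; ring, ENNReal.rpow_one,
      mul_comm, ENNReal.rpow_neg]
    gcongr
    exact ENNReal.div_le_of_le_mul' (hx hxQ)
  have hmp : m Q ^ p = m Q ^ (p - 1) * m Q := by
    have := ENNReal.rpow_add (p - 1) 1 hm0 hmt
    rwa [sub_add_cancel, ENNReal.rpow_one] at this
  have hAp0 : A ^ (p - 1) ≠ 0 := by simp [ENNReal.rpow_eq_zero_iff, hA0, hAt]
  have hApt : A ^ (p - 1) ≠ ∞ := ENNReal.rpow_ne_top_of_nonneg hp1.le hAt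
  clear_value A B
  refine (mul_le_mul' (ENNReal.rpow_le_rpow h2 hp1.le) h1).trans (le_of_eq ?_)
  rw [ENNReal.mul_rpow_of_nonneg _ _ hp1.le, ENNReal.mul_rpow_of_nonneg _ _ hp1.le,
    ENNReal.inv_rpow, ← ENNReal.rpow_mul, one_div_mul_cancel hp1.ne', ENNReal.rpow_one, hmp,
    ENNReal.div_rpow_of_nonneg _ _ hp1.le, ENNReal.inv_div (Or.inl hbt) (Or.inl hb0),
    ENNReal.inv_div (Or.inl (ENNReal.rpow_ne_top_of_nonneg hp1.le hat))
      (Or.inl (by simp [ENNReal.rpow_eq_zero_iff, ha0, hat]))]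
  simp only [div_eq_mul_inv]
  calc _ = b * a ^ (p - 1) * (m Q ^ (p - 1) * m Q) * (A ^ (p - 1) * (A ^ (p - 1))⁻¹) *
        (B * B⁻¹) := by ring
    _ = _ := by rw [ENNReal.mul_inv_cancel hAp0 hApt, ENNReal.mul_inv_cancel hB0 hBt, mul_one,
        mul_one]

end MuckenhouptConditions

section DyadicGrids

/-- The shift of the level-`k` dyadic intervals, relative to their length. -/
noncomputable def gridShift (b : Bool) (k : ℤ) : ℝ := if b then (-1) ^ k / 3 else 0

/-- The cubes of the dyadic grid in `ℝⁿ` shifted according to `α`. -/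
def gridCube {n : ℕ} (α : Fin n → Bool) (j : ℤ × (Fin n → ℤ)) : Set (Fin n → ℝ) :=
  Set.univ.pi fun i => Set.Ico ((2 : ℝ) ^ j.1 * (j.2 i + gridShift (α i) j.1))
    ((2 : ℝ) ^ j.1 * (j.2 i + gridShift (α i) j.1) + 2 ^ j.1)

theorem mem_gridCube {n : ℕ} {α : Fin n → Bool} {j : ℤ × (Fin n → ℤ)} {x : Fin n → ℝ} :
    x ∈ gridCube α j ↔ ∀ i, ⌊x i / 2 ^ j.1 - gridShift (α i) j.1⌋ = j.2 i := by
  have h2 : (0 : ℝ) < 2 ^ j.1 := by positivity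
  simp only [gridCube, Set.mem_univ_pi, Set.mem_Ico, Int.floor_eq_iff]
  refine forall_congr' fun i => ?_
  rw [le_sub_iff_add_le, le_div_iff₀ h2, sub_lt_iff_lt_add, div_lt_iff₀ h2]
  constructor <;> rintro ⟨h, h'⟩ <;> constructor <;> linarith

theorem measurableSet_gridCube {n : ℕ} (α : Fin n → Bool) (j : ℤ × (Fin n → ℤ)) :
    MeasurableSet (gridCube α j) :=
  MeasurableSet.univ_pi fun _ => measurableSet_Ico

theorem volume_gridCube {n : ℕ} (α : Fin n → Bool) (j : ℤ × (Fin n → ℤ)) :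
    volume (gridCube α j) = ENNReal.ofReal (2 ^ j.1) ^ n := by
  simp [gridCube, Real.volume_pi_Ico]

theorem volume_cube {n : ℕ} (a : Fin n → ℝ) (h : ℝ) :
    volume {x : Fin n → ℝ | ∀ i, a i ≤ x i ∧ x i ≤ a i + h} = ENNReal.ofReal h ^ n := by
  have : {x : Fin n → ℝ | ∀ i, a i ≤ x i ∧ x i ≤ a i + h} = Set.Icc a (fun i => a i + h) := by
    ext x
    simp [Set.mem_Icc, Pi.le_def, forall_and]
  rw [this, Real.volume_Icc_pi]
  simp

theorem floor_grid_succ (b : Bool) (k : ℤ) {x y : ℝ}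
    (h : ⌊x / 2 ^ k - gridShift b k⌋ = ⌊y / 2 ^ k - gridShift b k⌋) :
    ⌊x / 2 ^ (k + 1) - gridShift b (k + 1)⌋ = ⌊y / 2 ^ (k + 1) - gridShift b (k + 1)⌋ := by
  have hshift : gridShift b (k + 1) = -gridShift b k := by
    cases b
    · simp [gridShift]
    · simp only [gridShift, if_true]
      rw [zpow_add_one₀ (by norm_num)]
      ring
  obtain ⟨e, he⟩ : ∃ e : ℤ, 3 * gridShift b k = e := by
    cases b
    · exact ⟨0, by simp [gridShift]⟩
    · rcases Int.even_or_odd k with hk | hk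
      · exact ⟨1, by simp [gridShift, hk.neg_one_zpow]⟩
      · exact ⟨-1, by norm_num [gridShift, hk.neg_one_zpow]⟩
  have key : ∀ z : ℝ, ⌊z / 2 ^ (k + 1) - gridShift b (k + 1)⌋ =
      (⌊z / 2 ^ k - gridShift b k⌋ + e) / 2 := by
    intro z
    have : z / 2 ^ (k + 1) - gridShift b (k + 1) =
        (z / 2 ^ k - gridShift b k + e) / ((2 : ℕ) : ℝ) := by
      rw [hshift, ← he, zpow_add_one₀ (by norm_num)]
      push_cast
      field_simp
      ring
    rw [this, Int.floor_div_natCast, Int.floor_add_intCast]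
    rfl
  rw [key, key, h]

theorem isNestedFamily_gridCube {n : ℕ} (α : Fin n → Bool) : IsNestedFamily (gridCube α) := by
  have hmono : ∀ (N : ℕ) (k : ℤ) (b : Bool) (x y : ℝ),
      ⌊x / 2 ^ k - gridShift b k⌋ = ⌊y / 2 ^ k - gridShift b k⌋ →
      ⌊x / 2 ^ (k + N) - gridShift b (k + N)⌋ = ⌊y / 2 ^ (k + N) - gridShift b (k + N)⌋ := by
    intro N k b x y h
    induction N with
    | zero => simpa using h
    | succ N ih =>
      have := floor_grid_succ b (k + N) ih
      rw [add_assoc] at this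
      exact_mod_cast this
  have key : ∀ i j : ℤ × (Fin n → ℤ), i.1 ≤ j.1 →
      gridCube α i ⊆ gridCube α j ∨ Disjoint (gridCube α i) (gridCube α j) := by
    intro i j hij
    by_cases hd : Disjoint (gridCube α i) (gridCube α j)
    · exact Or.inr hd
    obtain ⟨z, hzi, hzj⟩ := Set.not_disjoint_iff.1 hd
    refine Or.inl fun x hx => mem_gridCube.2 fun l => ?_
    rw [← mem_gridCube.1 hzj l]
    obtain ⟨N, hN⟩ := Int.le.dest hij
    rw [← hN]
    exact hmono N i.1 (α l) _ _ ((mem_gridCube.1 hx l).trans (mem_gridCube.1 hzi l).symm)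
  intro i j
  rcases le_total i.1 j.1 with h | h
  · rcases key i j h with h' | h'
    · exact Or.inl h'
    · exact Or.inr (Or.inr h')
  · rcases key j i h with h' | h'
    · exact Or.inr (Or.inl h')
    · exact Or.inr (Or.inr h'.symm)

/-- The one-third trick: a short interval lies in an interval of one of the two shifted grids. -/
theorem exists_floor_grid_eq (k : ℤ) {y d : ℝ} (hd : d < 1 / 3) :
    ∃ b : Bool, ⌊y - gridShift b k⌋ = ⌊y + d - gridShift b k⌋ ∨ d < 0 := by
  by_contra! hcon
  have h0 : ∀ b, y - gridShift b k < ⌊y + d - gridShift b k⌋ := by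
    intro b
    have hle : ⌊y - gridShift b k⌋ ≤ ⌊y + d - gridShift b k⌋ :=
      Int.floor_le_floor (by linarith [(hcon b).2])
    exact Int.floor_lt.1 (lt_of_le_of_ne hle (hcon b).1)
  have hf := h0 false
  have ht := h0 true
  have hf' := Int.floor_le (y + d - gridShift false k)
  have ht' := Int.floor_le (y + d - gridShift true k)
  set m := ⌊y + d - gridShift false k⌋
  set m' := ⌊y + d - gridShift true k⌋
  rcases Int.even_or_odd k with hk | hk
  · simp only [gridShift, hk.neg_one_zpow, if_true, Bool.false_eq_true, if_false] at *
    have h1 : (m' : ℝ) < m := by linarith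
    have h2 : (m : ℝ) < m' + 1 := by linarith
    have h1' : m' < m := by exact_mod_cast h1
    have h2' : m < m' + 1 := by exact_mod_cast h2
    omega
  · simp only [gridShift, hk.neg_one_zpow, if_true, Bool.false_eq_true, if_false] at *
    have h1 : (m : ℝ) < m' := by linarith
    have h2 : (m' : ℝ) < m + 1 := by linarith
    have h1' : m < m' := by exact_mod_cast h1
    have h2' : m' < m + 1 := by exact_mod_cast h2
    omega

theorem IsCube.exists_subset_gridCube {n : ℕ} {Q : Set (Fin n → ℝ)} (hQ : IsCube Q) :
    ∃ (α : Fin n → Bool) (j : ℤ × (Fin n → ℤ)), Q ⊆ gridCube α j ∧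
      volume (gridCube α j) ≤ 6 ^ n * volume Q := by
  obtain ⟨a, h, hh, rfl⟩ := hQ
  obtain ⟨l, hl, hl'⟩ := exists_mem_Ico_zpow (x := 3 * h) (y := (2 : ℝ)) (by linarith) (by norm_num)
  set k := l + 1 with hk
  have h2 : (0 : ℝ) < 2 ^ k := by positivity
  have hk6 : (2 : ℝ) ^ k ≤ 6 * h := by
    rw [hk, zpow_add_one₀ (by norm_num)]
    linarith
  have hd : h / 2 ^ k < 1 / 3 := by rw [div_lt_iff₀ h2]; linarith
  have hd0 : 0 < h / 2 ^ k := by positivity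
  choose α hα using fun i => exists_floor_grid_eq k (y := a i / 2 ^ k) hd
  refine ⟨α, (k, fun i => ⌊a i / 2 ^ k - gridShift (α i) k⌋), fun x hx => ?_, ?_⟩
  · refine mem_gridCube.2 fun i => ?_
    have hi := (hα i).resolve_right (not_lt.2 hd0.le)
    rw [← add_div] at hi
    apply le_antisymm
    · simp only [hi]
      apply Int.floor_le_floor
      gcongr
      exact (hx i).2
    · apply Int.floor_le_floor
      simp only
      gcongr
      exact (hx i).1
  · rw [volume_gridCube, volume_cube, ← mul_pow]
    gcongr
    rw [show (6 : ℝ≥0∞) = ENNReal.ofReal 6 by norm_num, ← ENNReal.ofReal_mul (by norm_num)]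
    exact ENNReal.ofReal_le_ofReal hk6

/-- The dyadic maximal operator of a shifted grid. -/
noncomputable def gridMax {n : ℕ} (α : Fin n → Bool) (g : (Fin n → ℝ) → ℝ≥0∞) (x : Fin n → ℝ) :
    ℝ≥0∞ :=
  ⨆ S : Finset (ℤ × (Fin n → ℤ)), familyMax volume S (gridCube α) g x

theorem hlM_le_gridMax {n : ℕ} (g : (Fin n → ℝ) → ℝ≥0∞) (x : Fin n → ℝ) :
    hlM g x ≤ 6 ^ n * ⨆ α : Fin n → Bool, gridMax α g x := by
  refine iSup_le fun Q => iSup_le fun hQ => iSup_le fun hx => ?_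
  obtain ⟨α, j, hsub, hvol⟩ := hQ.exists_subset_gridCube
  have h1 : (∫⁻ y in gridCube α j, g y) / volume (gridCube α j) ≤
      ⨆ α : Fin n → Bool, gridMax α g x :=
    (le_familyMax (Finset.mem_singleton_self j) (hsub hx)).trans
      ((le_iSup (fun S => familyMax volume S (gridCube α) g x) {j}).trans
        (le_iSup (fun α => gridMax α g x) α))
  refine le_trans ?_ (mul_le_mul_right h1 _)
  have hQ0 : volume Q ≠ 0 := by
    obtain ⟨a, h, hh, rfl⟩ := hQ
    rw [volume_cube]
    exact pow_ne_zero _ (by simpa using hh)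
  have hQt : volume Q ≠ ∞ := by
    obtain ⟨a, h, hh, rfl⟩ := hQ
    rw [volume_cube]
    exact ENNReal.pow_ne_top ENNReal.ofReal_ne_top
  have h60 : (6 : ℝ≥0∞) ^ n ≠ 0 := pow_ne_zero _ (by norm_num)
  have h6t : (6 : ℝ≥0∞) ^ n ≠ ∞ := ENNReal.pow_ne_top (by norm_num)
  unfold cubeAvg
  calc (∫⁻ y in Q, g y) / volume Q
      = 6 ^ n * ((∫⁻ y in Q, g y) / (6 ^ n * volume Q)) := by
        simp only [div_eq_mul_inv]
        rw [ENNReal.mul_inv (Or.inl h60) (Or.inl h6t)]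
        calc _ = (6 ^ n * (6 ^ n)⁻¹) * ((∫⁻ y in Q, g y) * (volume Q)⁻¹) := by
              rw [ENNReal.mul_inv_cancel h60 h6t, one_mul]
          _ = _ := by ring
    _ ≤ 6 ^ n * ((∫⁻ y in gridCube α j, g y) / volume (gridCube α j)) :=
        mul_le_mul_right (ENNReal.div_le_div (lintegral_mono_set hsub) hvol) _

theorem gridCube_avg_le_hlM {n : ℕ} {α : Fin n → Bool} {j : ℤ × (Fin n → ℤ)}
    (g : (Fin n → ℝ) → ℝ≥0∞) {x : Fin n → ℝ} (hx : x ∈ gridCube α j) :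
    (∫⁻ y in gridCube α j, g y) / volume (gridCube α j) ≤ hlM g x := by
  set a : Fin n → ℝ := fun i => (2 : ℝ) ^ j.1 * (j.2 i + gridShift (α i) j.1) with ha
  set Q : Set (Fin n → ℝ) := {x | ∀ i, a i ≤ x i ∧ x i ≤ a i + 2 ^ j.1} with hQ
  have hsub : gridCube α j ⊆ Q := fun y hy i => ⟨(hy i trivial).1, (hy i trivial).2.le⟩
  have hcube : IsCube Q := ⟨a, 2 ^ j.1, by positivity, rfl⟩
  refine le_trans ?_ (le_iSup_of_le Q (le_iSup_of_le hcube (le_iSup_of_le (hsub hx) le_rfl)))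
  rw [cubeAvg, volume_gridCube, hQ, volume_cube]
  exact ENNReal.div_le_div_right (lintegral_mono_set hsub) _

theorem measurable_gridMax {n : ℕ} (α : Fin n → Bool) (g : (Fin n → ℝ) → ℝ≥0∞) :
    Measurable (gridMax α g) :=
  Measurable.iSup fun S => measurable_familyMax _ S (measurableSet_gridCube α) g

theorem lintegral_gridMax_rpow_mul_le {n : ℕ} (α : Fin n → Bool)
    {g w : (Fin n → ℝ) → ℝ≥0∞} (hw : Measurable w) {p : ℝ} (hp : 0 < p) {K : ℝ≥0∞}
    (hK : ∀ S : Finset (ℤ × (Fin n → ℤ)),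
      ∫⁻ x, familyMax volume S (gridCube α) g x ^ p * w x ≤ K) :
    ∫⁻ x, gridMax α g x ^ p * w x ≤ K := by
  have h1 : ∀ x, gridMax α g x ^ p * w x =
      ⨆ S : Finset (ℤ × (Fin n → ℤ)), familyMax volume S (gridCube α) g x ^ p * w x := by
    intro x
    rw [← ENNReal.iSup_mul]
    congr 1
    exact (ENNReal.orderIsoRpow p hp).map_iSup _
  simp only [h1]
  rw [lintegral_iSup_directed]
  · exact iSup_le hK
  · intro S
    exact (((measurable_familyMax _ S (measurableSet_gridCube α) g).pow_const _).mul hw).aemeasurable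
  · refine Monotone.directed_le fun S T hST x => ?_
    dsimp only
    gcongr
    exact biSup_mono fun i hi => hST hi

end DyadicGrids

section Weights

theorem hlM_congr_ae {n : ℕ} {f g : (Fin n → ℝ) → ℝ≥0∞} (h : f =ᵐ[volume] g) : hlM f = hlM g := by
  funext x
  simp only [hlM, cubeAvg]
  refine iSup_congr fun Q => iSup_congr fun _ => iSup_congr fun _ => ?_
  rw [lintegral_congr_ae (ae_restrict_of_ae h)]

theorem IsWeight.exists_measurable_representative {n : ℕ} {u : (Fin n → ℝ) → ℝ}
    (hu : IsWeight u) :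
    ∃ U : (Fin n → ℝ) → ℝ≥0∞, Measurable U ∧ (∀ x, U x ≠ 0) ∧ (∀ x, U x ≠ ∞) ∧
      (∀ᵐ x, U x = ENNReal.ofReal (u x)) ∧ ∀ᵐ x, hlM U x ≤ a1Const u * U x := by
  have hm := hu.1.aestronglyMeasurable
  set u₀ := hm.mk u with hu₀
  have hu₀m : Measurable u₀ := hm.stronglyMeasurable_mk.measurable
  set U : (Fin n → ℝ) → ℝ≥0∞ := fun x => if 0 < u₀ x then ENNReal.ofReal (u₀ x) else 1 with hU
  have hae : ∀ᵐ x, U x = ENNReal.ofReal (u x) := by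
    filter_upwards [hm.ae_eq_mk, hu.2] with x hx hpos
    rw [hx] at hpos
    simp only [hU]
    rw [if_pos hpos, hx]
  have hU0 : ∀ x, U x ≠ 0 := by
    intro x
    simp only [hU]
    split_ifs with h
    · simpa using h
    · exact one_ne_zero
  have hUt : ∀ x, U x ≠ ∞ := by
    intro x
    simp only [hU]
    split_ifs with h
    · exact ENNReal.ofReal_ne_top
    · exact ENNReal.one_ne_top
  refine ⟨U, Measurable.ite (measurableSet_lt measurable_const hu₀m) hu₀m.ennreal_ofReal
    measurable_const, hU0, hUt, hae, ?_⟩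
  rw [hlM_congr_ae hae]
  filter_upwards [hae, ENNReal.ae_le_essSup (μ := volume)
    (fun x => hlM (fun y => ENNReal.ofReal (u y)) x / ENNReal.ofReal (u x))] with x hx hle
  rw [← hx, ENNReal.div_le_iff (hU0 x) (hUt x)] at hle
  exact hle

theorem ofReal_rpow_one_div_sub_one_le {p : ℝ} (hp : 1 < p) :
    ENNReal.ofReal p ^ (1 / (p - 1)) ≤ 3 := by
  have hp1 : 0 < p - 1 := by linarith
  rw [ENNReal.ofReal_rpow_of_pos (by linarith), show (3 : ℝ≥0∞) = ENNReal.ofReal 3 by norm_num]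
  apply ENNReal.ofReal_le_ofReal
  rw [Real.rpow_def_of_pos (by linarith)]
  calc Real.exp (Real.log p * (1 / (p - 1))) ≤ Real.exp 1 := by
        apply Real.exp_le_exp.2
        rw [mul_one_div, div_le_one hp1]
        exact Real.log_le_sub_one_of_pos (by linarith)
    _ ≤ 3 := by linarith [Real.exp_one_lt_d9]

/-- The `L^p(V U^{1-p})` bound for the maximal operator when `U` and `V` are `A₁` weights. -/
theorem lintegral_hlM_rpow_mul_le {n : ℕ} {U V : (Fin n → ℝ) → ℝ≥0∞}
    (hU : Measurable U) (hV : Measurable V)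
    (hU0 : ∀ x, U x ≠ 0) (hUt : ∀ x, U x ≠ ∞) (hV0 : ∀ x, V x ≠ 0) (hVt : ∀ x, V x ≠ ∞)
    {a b : ℝ≥0∞} (hat : a ≠ ∞) (hbt : b ≠ ∞)
    (ha : ∀ᵐ x, hlM U x ≤ a * U x) (hb : ∀ᵐ x, hlM V x ≤ b * V x) {p : ℝ} (hp : 1 < p)
    {g : (Fin n → ℝ) → ℝ≥0∞} (hg : Measurable g) :
    ∫⁻ x, hlM g x ^ p * (V x * U x ^ (1 - p)) ≤
      (6 ^ n * 2 ^ n * (b ^ (1 / (p - 1)) * a * 3 * ENNReal.ofReal (p / (p - 1)))) ^ p *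
        ∫⁻ x, g x ^ p * (V x * U x ^ (1 - p)) := by
  have hp0 : 0 < p := by linarith
  have hp1 : 0 < p - 1 := by linarith
  set w : (Fin n → ℝ) → ℝ≥0∞ := fun x => V x * U x ^ (1 - p) with hwdef
  have hw : Measurable w := hV.mul (hU.pow_const _)
  have hw0 : ∀ x, w x ≠ 0 := fun x =>
    mul_ne_zero (hV0 x) (by simp [ENNReal.rpow_eq_zero_iff, hU0, hUt])
  have hwt : ∀ x, w x ≠ ∞ := fun x =>
    ENNReal.mul_ne_top (hVt x) (by simp [ENNReal.rpow_eq_top_iff, hU0, hUt])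
  have hvol0 : ∀ (α : Fin n → Bool) j, volume (gridCube α j) ≠ 0 := by
    intro α j
    rw [volume_gridCube]
    have : (0 : ℝ) < 2 ^ j.1 := by positivity
    exact pow_ne_zero _ (by simpa using this)
  have hvolt : ∀ (α : Fin n → Bool) j, volume (gridCube α j) ≠ ∞ := by
    intro α j
    rw [volume_gridCube]
    exact ENNReal.pow_ne_top ENNReal.ofReal_ne_top
  set B := b ^ (1 / (p - 1)) * a * 3 * ENNReal.ofReal (p / (p - 1)) with hB
  set I := ∫⁻ x, g x ^ p * w x with hI
  have hgrid : ∀ α : Fin n → Bool, ∫⁻ x, gridMax α g x ^ p * w x ≤ B ^ p * I := by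
    intro α
    refine lintegral_gridMax_rpow_mul_le α hw hp0 fun S => ?_
    have hbuckley := (isNestedFamily_gridCube α).lintegral_familyMax_rpow_mul_le
      (measurableSet_gridCube α) volume S (fun i _ => hvol0 α i) (fun i _ => hvolt α i) hw hw0 hwt
      hp (A := b * a ^ (p - 1))
      (ENNReal.mul_ne_top hbt (ENNReal.rpow_ne_top_of_nonneg hp1.le hat))
      (fun i _ => lintegral_dual_rpow_mul_lintegral_le
        (hvol0 α i) (hvolt α i) hU hV hU0 hUt hV0 hVt hat hbt
        (ha.mono fun x hx hxi => (gridCube_avg_le_hlM U hxi).trans hx)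
        (hb.mono fun x hx hxi => (gridCube_avg_le_hlM V hxi).trans hx) hp) hg
    refine hbuckley.trans (mul_le_mul_left (ENNReal.rpow_le_rpow ?_ hp0.le) _)
    rw [ENNReal.mul_rpow_of_nonneg _ _ (by positivity), ← ENNReal.rpow_mul,
      mul_one_div_cancel hp1.ne', ENNReal.rpow_one]
    simp only [hB]
    gcongr
    exact ofReal_rpow_one_div_sub_one_le hp
  change ∫⁻ x, hlM g x ^ p * w x ≤ (6 ^ n * 2 ^ n * B) ^ p * I
  clear_value B w I
  calc ∫⁻ x, hlM g x ^ p * w x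
      ≤ ∫⁻ x, (6 ^ n) ^ p * ∑ α : Fin n → Bool, gridMax α g x ^ p * w x := by
        refine lintegral_mono fun x => ?_
        dsimp only
        rw [← Finset.sum_mul, ← mul_assoc]
        gcongr
        refine (ENNReal.rpow_le_rpow (hlM_le_gridMax g x) hp0.le).trans ?_
        rw [ENNReal.mul_rpow_of_nonneg _ _ hp0.le]
        refine mul_le_mul_right ?_ _
        refine (le_of_eq ((ENNReal.orderIsoRpow p hp0).map_iSup _)).trans (iSup_le fun α => ?_)
        exact Finset.single_le_sum (f := fun α => gridMax α g x ^ p) (fun _ _ => zero_le)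
          (Finset.mem_univ α)
    _ = (6 ^ n) ^ p * ∑ α : Fin n → Bool, ∫⁻ x, gridMax α g x ^ p * w x := by
        have hmeas : ∀ α : Fin n → Bool, Measurable fun x => gridMax α g x ^ p * w x :=
          fun α => ((measurable_gridMax α g).pow_const _).mul hw
        rw [lintegral_const_mul _ (Finset.measurable_fun_sum _ fun α _ => hmeas α),
          lintegral_finsetSum _ fun α _ => hmeas α]
    _ ≤ (6 ^ n) ^ p * ∑ _α : Fin n → Bool, B ^ p * I := by
        gcongr with α
        exact hgrid α
    _ = (6 ^ n) ^ p * (2 ^ n * (B ^ p * I)) := by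
        simp
    _ ≤ (6 ^ n) ^ p * ((2 ^ n) ^ p * (B ^ p * I)) := by
        gcongr
        have h1 : (1 : ℝ≥0∞) ≤ 2 ^ n := one_le_pow₀ (by norm_num)
        calc (2 : ℝ≥0∞) ^ n = (2 ^ n) ^ (1 : ℝ) := (ENNReal.rpow_one _).symm
          _ ≤ (2 ^ n) ^ p := ENNReal.rpow_le_rpow_of_exponent_le h1 hp.le
    _ = _ := by
        rw [ENNReal.mul_rpow_of_nonneg _ _ hp0.le, ENNReal.mul_rpow_of_nonneg _ _ hp0.le]
        ring

end Weights

/-- **Buckley-type bound for `S f = M(fu)/u` on `L^p(uv)`.** For `u, v ∈ A₁` and `1 < p < ∞`,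
`‖M(fu)/u‖_{L^p(uv)} ≤ c_n p' [v]_{A₁}^{1/(p-1)} [u]_{A₁} ‖f‖_{L^p(uv)}`. -/
theorem Buckley_type_Lp_bound (n : ℕ) :
    ∃ c : ℝ≥0, 0 < c ∧
      ∀ p : ℝ, 1 < p → ∀ u v : (Fin n → ℝ) → ℝ, IsWeight u → IsWeight v →
        a1Const u ≠ ∞ → a1Const v ≠ ∞ →
        ∀ f : (Fin n → ℝ) → ℝ, Measurable f →
          (∫⁻ x, ENNReal.ofReal |f x| ^ p * ENNReal.ofReal (u x * v x)) ≠ ∞ →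
          lpNormE p (fun x => hlMR (fun y => f y * u y) x / ENNReal.ofReal (u x))
              (fun x => u x * v x) ≤
            (c : ℝ≥0∞) * ENNReal.ofReal (p / (p - 1)) * a1Const v ^ (1 / (p - 1)) *
              a1Const u *
              lpNormE p (fun x => ENNReal.ofReal |f x|) (fun x => u x * v x) := by
  refine ⟨6 ^ n * 2 ^ n * 3, by positivity, ?_⟩
  intro p hp u v hu hv hau hav f hf _
  have hp0 : 0 < p := by linarith
  obtain ⟨U, hU, hU0, hUt, hUae, hUA⟩ := hu.exists_measurable_representative
  obtain ⟨V, hV, hV0, hVt, hVae, hVA⟩ := hv.exists_measurable_representative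
  set g : (Fin n → ℝ) → ℝ≥0∞ := fun x => ENNReal.ofReal |f x| * U x with hg
  have hgm : Measurable g := hf.abs.ennreal_ofReal.mul hU
  have huv : ∀ᵐ x, ENNReal.ofReal (u x * v x) = U x * V x := by
    filter_upwards [hUae, hVae, hu.2] with x h1 h2 h3
    rw [ENNReal.ofReal_mul h3.le, h1, h2]
  have hM : hlMR (fun y => f y * u y) = hlM g := by
    refine hlM_congr_ae ?_
    filter_upwards [hUae, hu.2] with x h1 h3
    simp only [hg]
    rw [abs_mul, abs_of_pos h3, ENNReal.ofReal_mul (abs_nonneg _), h1]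
  have hpow : ∀ x, U x * U x ^ (-p) = U x ^ (1 - p) := by
    intro x
    have := ENNReal.rpow_add 1 (-p) (hU0 x) (hUt x)
    rw [ENNReal.rpow_one] at this
    rw [← this, sub_eq_add_neg]
  have hL : ∫⁻ x, (hlMR (fun y => f y * u y) x / ENNReal.ofReal (u x)) ^ p *
      ENNReal.ofReal (u x * v x) = ∫⁻ x, hlM g x ^ p * (V x * U x ^ (1 - p)) := by
    refine lintegral_congr_ae ?_
    filter_upwards [hUae, huv] with x h1 h2
    rw [h2, ← h1, hM, ENNReal.div_rpow_of_nonneg _ _ hp0.le, div_eq_mul_inv, ← ENNReal.rpow_neg,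
      ← hpow]
    ring
  have hR : ∫⁻ x, ENNReal.ofReal |f x| ^ p * ENNReal.ofReal (u x * v x) =
      ∫⁻ x, g x ^ p * (V x * U x ^ (1 - p)) := by
    refine lintegral_congr_ae ?_
    filter_upwards [huv] with x h2
    have h3 : U x ^ p * U x ^ (1 - p) = U x := by
      rw [← ENNReal.rpow_add _ _ (hU0 x) (hUt x), add_sub_cancel, ENNReal.rpow_one]
    rw [h2, ENNReal.mul_rpow_of_nonneg _ _ hp0.le, mul_assoc, mul_left_comm (U x ^ p), h3,
      mul_comm (V x)]
  unfold lpNormE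
  rw [hL, hR]
  refine (ENNReal.rpow_le_rpow (lintegral_hlM_rpow_mul_le hU hV hU0 hUt hV0 hVt hau hav hUA hVA
    hp hgm) (by positivity)).trans (le_of_eq ?_)
  rw [ENNReal.mul_rpow_of_nonneg _ _ (by positivity), ← ENNReal.rpow_mul,
    mul_one_div_cancel hp0.ne', ENNReal.rpow_one]
  push_cast
  ring
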